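/- arXiv:2008.01056 — 2 statements merged into one kernel-verified Lean document; each statement's English description precedes it below -/
import Mathlib

section
/- Let n be a positive integer, let G be either the path graph P_n, or (assuming n ≥ 3) the cycle graph C_n, and let f be an efficient resolving broadcast of G. Then there exists an efficient resolving broadcast f' of G with the following two properties: (1) every vertex of G that is reached by f is also reached by f'; (2) f'(v) ≤ 1 for all v ∈ V(G). -/
open SimpleGraph

/-- `f` is a resolving broadcast of `G`: for any two distinct vertices `x, y` there is a
vertex `z` with `f z > 0` such that `min (d(x,z)) (f z + 1) ≠ min (d(y,z)) (f z + 1)`,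
where distances are extended naturals (`⊤` for vertices in different components). -/
def IsResolvingBroadcast {V : Type*} (G : SimpleGraph V) (f : V → ℕ) : Prop :=
  ∀ x y : V, x ≠ y → ∃ z : V, 0 < f z ∧
    min (G.edist x z) ((f z : ℕ∞) + 1) ≠ min (G.edist y z) ((f z : ℕ∞) + 1)

/-- The broadcast dimension of `G`: the minimum of `∑ v, f v` over all
resolving broadcasts `f` of `G`. -/
noncomputable def bdim {V : Type*} [Fintype V] (G : SimpleGraph V) : ℕ :=
  sInf {n : ℕ | ∃ f : V → ℕ, IsResolvingBroadcast G f ∧ ∑ v, f v = n}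

/-- A vertex `w` is reached by `f` in `G`: some vertex `z` with `f z > 0` has
`d(w, z) ≤ f z`. -/
def Reaches {V : Type*} (G : SimpleGraph V) (f : V → ℕ) (w : V) : Prop :=
  ∃ z : V, 0 < f z ∧ G.edist w z ≤ (f z : ℕ∞)

namespace SimpleGraph

/-- A potential that changes by at most one along edges, and can be decreased by moving to a
neighbour away from its zero `z`, is the distance to `z`. -/
lemma edist_eq_of_potential {V : Type*} {G : SimpleGraph V} {z : V} {D : V → ℕ}
    (hz : D z = 0) (hlip : ∀ x y, G.Adj x y → D x ≤ D y + 1)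
    (hdec : ∀ x, x ≠ z → ∃ y, G.Adj x y ∧ D y < D x) (x : V) : G.edist x z = D x := by
  apply le_antisymm
  · induction h : D x using Nat.strong_induction_on generalizing x with
    | _ k ih =>
      subst h
      by_cases hx : x = z
      · subst hx; simp
      obtain ⟨y, hxy, hy⟩ := hdec x hx
      calc G.edist x z ≤ G.edist x y + G.edist y z := G.edist_triangle
        _ ≤ 1 + (D y : ℕ∞) :=
          add_le_add (edist_eq_one_iff_adj.2 hxy).le (ih _ hy y rfl)
        _ ≤ D x := by exact_mod_cast (by omega : 1 + D y ≤ D x)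
  · have hw : ∀ (a b : V) (p : G.Walk a b), D a ≤ D b + p.length := by
      intro a b p
      induction p with
      | nil => simp
      | cons h p ih =>
        have := hlip _ _ h
        simp only [Walk.length_cons]
        omega
    refine le_iInf fun p => ?_
    have := hw x z p
    exact_mod_cast (by omega : D x ≤ p.length)

lemma pathGraph_edist {n : ℕ} (x z : Fin n) :
    (pathGraph n).edist x z = (((x : ℕ) - z + (z - x) : ℕ) : ℕ∞) := by
  refine edist_eq_of_potential (D := fun x : Fin n => (x : ℕ) - z + (z - x)) (by simp) ?_ ?_ x
  · intro x y h
    rw [pathGraph_adj] at h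
    omega
  · intro x hx
    have hx' : (x : ℕ) ≠ z := fun h => hx (Fin.ext h)
    rcases lt_or_gt_of_ne hx' with h | h
    · refine ⟨⟨x + 1, by omega⟩, ?_, ?_⟩
      · rw [pathGraph_adj]; simp
      · dsimp only; omega
    · refine ⟨⟨x - 1, by omega⟩, ?_, ?_⟩
      · rw [pathGraph_adj]; dsimp only; omega
      · dsimp only; omega

lemma cycleGraph_adj_iff_val {n : ℕ} (hn : 2 ≤ n) {x y : Fin n} :
    (cycleGraph n).Adj x y ↔ (x : ℕ) + 1 = y ∨ (y : ℕ) + 1 = x ∨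
      ((x : ℕ) = 0 ∧ (y : ℕ) + 1 = n) ∨ ((y : ℕ) = 0 ∧ (x : ℕ) + 1 = n) := by
  rw [cycleGraph_adj']
  have hx := x.2
  have hy := y.2
  rcases lt_trichotomy x y with h | h | h
  · rw [Fin.coe_sub_iff_lt.2 h, Fin.coe_sub_iff_le.2 h.le]
    rw [Fin.lt_def] at h
    omega
  · subst h
    rw [Fin.coe_sub_iff_le.2 le_rfl]
    omega
  · rw [Fin.coe_sub_iff_lt.2 h, Fin.coe_sub_iff_le.2 h.le]
    rw [Fin.lt_def] at h
    omega

lemma cycleGraph_edist {n : ℕ} (hn : 2 ≤ n) (x z : Fin n) :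
    (cycleGraph n).edist x z =
      ((min ((x : ℕ) - z + (z - x)) (n - ((x : ℕ) - z + (z - x))) : ℕ) : ℕ∞) := by
  refine edist_eq_of_potential
    (D := fun x : Fin n => min ((x : ℕ) - z + (z - x)) (n - ((x : ℕ) - z + (z - x))))
    (by simp) ?_ ?_ x
  · intro x y h
    rw [cycleGraph_adj_iff_val hn] at h
    omega
  · intro x hx
    have hx' : (x : ℕ) ≠ z := fun h => hx (Fin.ext h)
    have hxn := x.2
    have hzn := z.2
    have key : ∃ y : ℕ, y < n ∧ ((x : ℕ) + 1 = y ∨ y + 1 = x ∨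
        ((x : ℕ) = 0 ∧ y + 1 = n) ∨ (y = 0 ∧ (x : ℕ) + 1 = n)) ∧
        min (y - z + (z - y)) (n - (y - z + (z - y))) <
          min ((x : ℕ) - z + (z - x)) (n - ((x : ℕ) - z + (z - x))) := by
      by_cases hup : ((x : ℕ) < z ∧ (z : ℕ) - x ≤ n - (z - x)) ∨
          ((z : ℕ) < x ∧ n - ((x : ℕ) - z) < x - z)
      · by_cases hlast : (x : ℕ) + 1 = n
        · exact ⟨0, by omega, by omega, by omega⟩
        · exact ⟨x + 1, by omega, by omega, by omega⟩
      · by_cases hfirst : (x : ℕ) = 0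
        · exact ⟨n - 1, by omega, by omega, by omega⟩
        · exact ⟨x - 1, by omega, by omega, by omega⟩
    obtain ⟨y, hy, hadj, hlt⟩ := key
    exact ⟨⟨y, hy⟩, (cycleGraph_adj_iff_val hn).2 hadj, hlt⟩

end SimpleGraph

open scoped Classical in
/-- In a graph whose spheres have at most two vertices, a resolving broadcast must spend at least
two fifths of the size of any set `A` it reaches, already on the vertices `Z` that reach `A`. -/
lemma IsResolvingBroadcast.two_mul_card_le {V : Type*} [Fintype V] {G : SimpleGraph V}
    (hG : ∀ z u v w : V, G.edist u z = G.edist v z → G.edist v z = G.edist w z →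
      G.edist u z ≠ ⊤ → u = v ∨ v = w ∨ u = w)
    {f : V → ℕ} (hf : IsResolvingBroadcast G f) (A Z : Finset V)
    (hA : ∀ v ∈ A, Reaches G f v)
    (hZ : ∀ v ∈ A, ∀ z, 0 < f z → G.edist v z ≤ f z → z ∈ Z) :
    2 * A.card ≤ 5 * ∑ z ∈ Z, f z := by
  let I : V → V → Prop := fun z v => 0 < f z ∧ G.edist v z ≤ f z
  let E : V → V → Prop := fun z v => I z v ∧ ∀ z', I z' v → z' = z
  have hlow : ∀ v ∈ A, 2 ≤ (Z.filter (I · v)).card + (Z.filter (E · v)).card := by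
    intro v hv
    obtain ⟨z, hz⟩ := hA v hv
    have hzZ : z ∈ Z.filter (I · v) := Finset.mem_filter.2 ⟨hZ v hv z hz.1 hz.2, hz⟩
    by_cases h : ∃ z', I z' v ∧ z' ≠ z
    · obtain ⟨z', hz', hne⟩ := h
      have : 1 < (Z.filter (I · v)).card :=
        Finset.one_lt_card.2 ⟨z', Finset.mem_filter.2 ⟨hZ v hv z' hz'.1 hz'.2, hz'⟩, z, hzZ, hne⟩
      omega
    · push Not at h
      have h1 : 0 < (Z.filter (I · v)).card := Finset.card_pos.2 ⟨z, hzZ⟩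
      have h2 : 0 < (Z.filter (E · v)).card :=
        Finset.card_pos.2 ⟨z, Finset.mem_filter.2 ⟨hZ v hv z hz.1 hz.2, hz, h⟩⟩
      omega
  have hup : ∀ z, (A.filter (I z)).card + (A.filter (E z)).card ≤ 5 * f z := by
    intro z
    rcases Nat.eq_zero_or_pos (f z) with h0 | hpos
    · have h1 : A.filter (I z) = ∅ := Finset.filter_eq_empty_iff.2 fun v _ h => by
        have := h.1; omega
      have h2 : A.filter (E z) = ∅ := Finset.filter_eq_empty_iff.2 fun v _ h => by
        have := h.1.1; omega
      simp [h1, h2]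
    have hmaps : ∀ v, I z v → (G.edist v z).toNat ∈ Finset.range (f z + 1) := by
      intro v hv
      have := ENat.toNat_le_of_le_natCast hv.2
      simp only [Finset.mem_range]
      omega
    have hcoe : ∀ v, I z v → G.edist v z = ((G.edist v z).toNat : ℕ∞) := fun v hv =>
      (ENat.natCast_toNat (ne_top_of_le_ne_top (ENat.natCast_ne_top _) hv.2)).symm
    have hI : ∀ d ∈ Finset.range (f z), ((A.filter (I z)).filter
        fun v => (G.edist v z).toNat = d + 1).card ≤ 2 := by
      intro d _
      by_contra! h
      obtain ⟨u, v, w, hu, hv, hw, huv, huw, hvw⟩ := Finset.two_lt_card_iff.1 h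
      simp only [Finset.mem_filter] at hu hv hw
      have eu := hcoe u hu.1.2
      have ev := hcoe v hv.1.2
      have ew := hcoe w hw.1.2
      rw [hu.2] at eu
      rw [hv.2] at ev
      rw [hw.2] at ew
      rcases hG z u v w (eu.trans ev.symm) (ev.trans ew.symm) (eu ▸ ENat.natCast_ne_top _)
        with h | h | h <;> contradiction
    have hE : ∀ d ∈ Finset.range (f z), ((A.filter (E z)).filter
        fun v => (G.edist v z).toNat = d + 1).card ≤ 1 := by
      intro d _
      by_contra! h
      obtain ⟨u, hu, v, hv, huv⟩ := Finset.one_lt_card.1 h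
      simp only [Finset.mem_filter] at hu hv
      have eu := hcoe u hu.1.2.1
      have ev := hcoe v hv.1.2.1
      rw [hu.2] at eu
      rw [hv.2] at ev
      obtain ⟨z', hz', hne⟩ := hf u v huv
      have hfar : ∀ t, E z t → z' ≠ z → min (G.edist t z') ((f z' : ℕ∞) + 1) = (f z' : ℕ∞) + 1 := by
        intro t ht hz
        refine min_eq_right (Order.add_one_le_of_lt (lt_of_not_ge fun hle => ?_))
        exact hz (ht.2 z' ⟨hz', hle⟩)
      by_cases hzz : z' = z
      · subst hzz
        exact hne (by rw [eu, ev])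
      · exact hne (by rw [hfar u hu.1.2 hzz, hfar v hv.1.2 hzz])
    have hzero : ∀ (P : V → Prop) [DecidablePred P], (∀ v, P v → I z v) → ((A.filter P).filter
        fun v => (G.edist v z).toNat = 0).card ≤ 1 := by
      intro P _ hP
      refine Finset.card_le_one.2 fun u hu v hv => ?_
      simp only [Finset.mem_filter] at hu hv
      have eu := hcoe u (hP u hu.1.2)
      have ev := hcoe v (hP v hv.1.2)
      rw [hu.2, Nat.cast_zero, edist_eq_zero_iff] at eu
      rw [hv.2, Nat.cast_zero, edist_eq_zero_iff] at ev
      rw [eu, ev]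
    have cI := Finset.card_eq_sum_card_fiberwise (s := A.filter (I z))
      (t := Finset.range (f z + 1)) (f := fun v => (G.edist v z).toNat)
      (fun v hv => hmaps v (Finset.mem_filter.1 hv).2)
    have cE := Finset.card_eq_sum_card_fiberwise (s := A.filter (E z))
      (t := Finset.range (f z + 1)) (f := fun v => (G.edist v z).toNat)
      (fun v hv => hmaps v (Finset.mem_filter.1 hv).2.1)
    rw [Finset.sum_range_succ'] at cI cE
    have sI := Finset.sum_le_card_nsmul _ _ _ hI
    have sE := Finset.sum_le_card_nsmul _ _ _ hE
    have zI := hzero (I z) fun _ h => h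
    have zE := hzero (E z) fun _ h => h.1
    simp only [Finset.card_range, smul_eq_mul] at sI sE
    omega
  calc 2 * A.card = ∑ v ∈ A, 2 := by simp [mul_comm]
    _ ≤ ∑ v ∈ A, ((Z.filter (I · v)).card + (Z.filter (E · v)).card) := Finset.sum_le_sum hlow
    _ = ∑ z ∈ Z, ((A.filter (I z)).card + (A.filter (E z)).card) := by
      simp only [Finset.card_filter, Finset.sum_add_distrib]
      congr 1 <;> exact Finset.sum_comm
    _ ≤ ∑ z ∈ Z, 5 * f z := Finset.sum_le_sum fun z _ => hup z
    _ = 5 * ∑ z ∈ Z, f z := by rw [Finset.mul_sum]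

/-- A resolving broadcast leaves at most one vertex unreached. -/
lemma IsResolvingBroadcast.eq_of_not_reaches {V : Type*} {G : SimpleGraph V} {f : V → ℕ}
    (hf : IsResolvingBroadcast G f) {x y : V} (hx : ¬ Reaches G f x) (hy : ¬ Reaches G f y) :
    x = y := by
  by_contra hne
  obtain ⟨z, hz, h⟩ := hf x y hne
  have hfar : ∀ t, ¬ Reaches G f t → min (G.edist t z) ((f z : ℕ∞) + 1) = (f z : ℕ∞) + 1 :=
    fun t ht => min_eq_right (Order.add_one_le_of_lt (lt_of_not_ge fun hle => ht ⟨z, hz, hle⟩))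
  exact h (by rw [hfar x hx, hfar y hy])

open scoped Classical in
/-- A set of vertices in which adjacency tells apart any two vertices outside of it gives a
resolving broadcast with values at most one. If it is cheap enough, it replaces an efficient
broadcast. -/
lemma exists_efficient_of_landmarks {V : Type*} [Fintype V] {G : SimpleGraph V} {f : V → ℕ}
    (heff : ∑ w, f w = bdim G) (S : Finset V) (hcard : S.card ≤ ∑ w, f w)
    (hS : ∀ x y, x ≠ y → x ∉ S → y ∉ S →
      ∃ z ∈ S, (G.Adj x z ∧ ¬ G.Adj y z) ∨ (G.Adj y z ∧ ¬ G.Adj x z))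
    (hreach : ∀ w, Reaches G f w → w ∉ S → ∃ z ∈ S, G.Adj w z) :
    ∃ f' : V → ℕ, IsResolvingBroadcast G f' ∧ ∑ w, f' w = bdim G ∧
      (∀ w, Reaches G f w → Reaches G f' w) ∧ ∀ w, f' w ≤ 1 := by
  set g : V → ℕ := fun v => if v ∈ S then 1 else 0 with hg
  have g1 : ∀ z ∈ S, g z = 1 := fun z hz => by simp [hg, hz]
  have hres : IsResolvingBroadcast G g := by
    intro x y hxy
    by_cases hx : x ∈ S
    · refine ⟨x, by simp [g1 x hx], fun h => hxy ?_⟩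
      rw [SimpleGraph.edist_self, min_eq_left zero_le, eq_comm, g1 x hx, min_eq_iff] at h
      rcases h with h | h
      · exact (edist_eq_zero_iff.1 h.1).symm
      · norm_num at h
    by_cases hy : y ∈ S
    · refine ⟨y, by simp [g1 y hy], fun h => hxy ?_⟩
      rw [SimpleGraph.edist_self, min_eq_left zero_le, g1 y hy, min_eq_iff] at h
      rcases h with h | h
      · exact edist_eq_zero_iff.1 h.1
      · norm_num at h
    have key : ∀ u v z : V, G.Adj u z → ¬ G.Adj v z →
        min (G.edist u z) (((1 : ℕ) : ℕ∞) + 1) ≠ min (G.edist v z) (((1 : ℕ) : ℕ∞) + 1) ∨ v = z := by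
      intro u v z hu hv
      refine or_iff_not_imp_right.2 fun hvz h => ?_
      rw [edist_eq_one_iff_adj.2 hu, min_eq_left (by norm_num), eq_comm, min_eq_iff] at h
      rcases h with h | h
      · exact hv (edist_eq_one_iff_adj.1 h.1)
      · norm_num at h
    obtain ⟨z, hz, h | h⟩ := hS x y hxy hx hy
    · refine ⟨z, by simp [g1 z hz], ?_⟩
      rw [g1 z hz]
      exact (key x y z h.1 h.2).resolve_right fun h => hy (h ▸ hz)
    · refine ⟨z, by simp [g1 z hz], ?_⟩
      rw [g1 z hz]
      exact ((key y x z h.1 h.2).resolve_right fun h => hx (h ▸ hz)).symm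
  have hsum : ∑ w, g w = S.card := by simp [hg]
  refine ⟨g, hres, le_antisymm ?_ (Nat.sInf_le ⟨g, hres, rfl⟩), ?_, ?_⟩
  · rw [hsum, ← heff]; exact hcard
  · intro w hw
    by_cases hwS : w ∈ S
    · exact ⟨w, by simp [g1 w hwS], by simp⟩
    · obtain ⟨z, hz, h⟩ := hreach w hw hwS
      exact ⟨z, by simp [g1 z hz], by rw [g1 z hz, edist_eq_one_iff_adj.2 h]; norm_num⟩
  · intro w
    simp only [hg]
    split_ifs <;> simp

/-- The landmarks in a segment `{0, …, a - 1}`: two in every block of five vertices, in the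
pattern `.1.1.`, with the incomplete last block filled by `1`, `1.`, `.11` or `.1.1`. -/
def IsLandmark (a p : ℕ) : Prop :=
  p < a ∧ ((p % 5 = 1 ∧ p + 1 ≠ a) ∨ p % 5 = 3 ∨ (p % 5 = 0 ∧ (p + 1 = a ∨ p + 2 = a)) ∨
    (p % 5 = 2 ∧ p + 1 = a))

open scoped Classical in
lemma card_isLandmark_le {V : Type*} [Fintype V] (t : V → ℕ) (ht : Function.Injective t) (a : ℕ) :
    (Finset.univ.filter fun v => IsLandmark a (t v)).card ≤ (2 * a + 4) / 5 := by
  rw [← Finset.card_range ((2 * a + 4) / 5)]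
  refine Finset.card_le_card_of_injOn (fun v => (2 * t v + 1) / 5) ?_ ?_
  · intro v hv
    have hv := (Finset.mem_filter.1 hv).2
    simp only [Finset.coe_range, Set.mem_Iio]
    unfold IsLandmark at hv
    omega
  · intro u hu v hv h
    have hu := (Finset.mem_filter.1 hu).2
    have hv := (Finset.mem_filter.1 hv).2
    apply ht
    unfold IsLandmark at hu hv
    dsimp only at h
    omega

lemma IsLandmark.exists_near {a p : ℕ} (hp : p < a) :
    IsLandmark a p ∨ (0 < p ∧ IsLandmark a (p - 1)) ∨ IsLandmark a (p + 1) := by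
  unfold IsLandmark
  omega

/-- Two vertices between which an inner landmark sits are told apart by a further landmark. -/
lemma IsLandmark.exists_second {a p : ℕ} (h : IsLandmark a p) (h0 : 0 < p)
    (hl : ¬ IsLandmark a (p - 1)) (hr : ¬ IsLandmark a (p + 1)) :
    (2 ≤ p ∧ IsLandmark a (p - 2)) ∨ IsLandmark a (p + 2) := by
  obtain ⟨hp, h | h | h | h⟩ := h
  · by_cases ha : p + 2 = a
    · exact absurd ⟨by omega, by omega⟩ hr
    · exact Or.inr ⟨by omega, by omega⟩
  · exact Or.inl ⟨by omega, by omega, by omega⟩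
  · exact Or.inl ⟨by omega, by omega, by omega⟩
  · exact absurd ⟨by omega, by omega⟩ hl

/-- The case of a path cut into segments of lengths `a` and `b`, with at most one vertex
between them. -/
lemma exists_efficient_pathGraph {n : ℕ} {f : Fin n → ℕ} (heff : ∑ w, f w = bdim (pathGraph n))
    {a b : ℕ} (hab : a + b = n ∨ a + b + 1 = n)
    (hcard : (2 * a + 4) / 5 + (2 * b + 4) / 5 ≤ ∑ w, f w)
    (hreach : ∀ w : Fin n, Reaches (pathGraph n) f w → a + b = n ∨ (w : ℕ) ≠ a) :
    ∃ f' : Fin n → ℕ, IsResolvingBroadcast (pathGraph n) f' ∧ ∑ w, f' w = bdim (pathGraph n) ∧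
      (∀ w, Reaches (pathGraph n) f w → Reaches (pathGraph n) f' w) ∧ ∀ w, f' w ≤ 1 := by
  classical
  let M : ℕ → Prop := fun v => v < n ∧ (IsLandmark a v ∨ IsLandmark b (n - 1 - v))
  have hdom : ∀ v < n, (a + b = n ∨ v ≠ a) → ¬ M v →
      ∃ u < n, M u ∧ (v + 1 = u ∨ u + 1 = v) := by
    intro v hv hva hM
    rcases lt_or_ge v a with h | h
    · rcases IsLandmark.exists_near h with h | h | h
      · exact absurd ⟨hv, Or.inl h⟩ hM
      · exact ⟨v - 1, by omega, ⟨by omega, Or.inl h.2⟩, by omega⟩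
      · have := h.1
        exact ⟨v + 1, by omega, ⟨by omega, Or.inl h⟩, by omega⟩
    · rcases IsLandmark.exists_near (a := b) (p := n - 1 - v) (by omega) with h | h | h
      · exact absurd ⟨hv, Or.inr h⟩ hM
      · exact ⟨v + 1, by omega, ⟨by omega, Or.inr ((by omega : n - 1 - (v + 1) = n - 1 - v - 1) ▸ h.2)⟩,
          by omega⟩
      · have := h.1
        exact ⟨v - 1, by omega, ⟨by omega, Or.inr ((by omega : n - 1 - (v - 1) = n - 1 - v + 1) ▸ h)⟩,
          by omega⟩
  have hpair : ∀ v, M v → 0 < v → v + 1 < n → ¬ M (v - 1) → ¬ M (v + 1) →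
      (2 ≤ v ∧ M (v - 2)) ∨ M (v + 2) := by
    intro v hv h0 h1 hl hr
    have hl1 : ¬ IsLandmark a (v - 1) := fun h => hl ⟨by omega, Or.inl h⟩
    have hr1 : ¬ IsLandmark a (v + 1) := fun h => hr ⟨by omega, Or.inl h⟩
    have hl2 : ¬ IsLandmark b (n - 1 - v + 1) := fun h =>
      hl ⟨by omega, Or.inr ((by omega : n - 1 - (v - 1) = n - 1 - v + 1) ▸ h)⟩
    have hr2 : ¬ IsLandmark b (n - 1 - v - 1) := fun h =>
      hr ⟨by omega, Or.inr ((by omega : n - 1 - (v + 1) = n - 1 - v - 1) ▸ h)⟩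
    rcases hv.2 with h | h
    · rcases h.exists_second h0 hl1 hr1 with h | h
      · exact Or.inl ⟨h.1, by omega, Or.inl h.2⟩
      · have := h.1
        exact Or.inr ⟨by omega, Or.inl h⟩
    · rcases h.exists_second (by omega) hr2 hl2 with h | h
      · exact Or.inr ⟨by omega, Or.inr ((by omega : n - 1 - (v + 2) = n - 1 - v - 2) ▸ h.2)⟩
      · have := h.1
        exact Or.inl ⟨by omega, by omega,
          Or.inr ((by omega : n - 1 - (v - 2) = n - 1 - v + 2) ▸ h)⟩
  have hsep : ∀ x y, x < n → y < n → x < y → ¬ M x → ¬ M y →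
      ∃ z < n, M z ∧ (((x + 1 = z ∨ z + 1 = x) ∧ ¬ (y + 1 = z ∨ z + 1 = y)) ∨
        ((y + 1 = z ∨ z + 1 = y) ∧ ¬ (x + 1 = z ∨ z + 1 = x))) := by
    intro x y hx hy hxy hMx hMy
    have hz : ∃ z < n, M z ∧ ((x + 1 = z ∨ z + 1 = x) ∨ (y + 1 = z ∨ z + 1 = y)) := by
      by_cases hxa : a + b = n ∨ x ≠ a
      · obtain ⟨z, h1, h2, h3⟩ := hdom x hx hxa hMx
        exact ⟨z, h1, h2, Or.inl h3⟩
      · obtain ⟨z, h1, h2, h3⟩ := hdom y hy (by omega) hMy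
        exact ⟨z, h1, h2, Or.inr h3⟩
    obtain ⟨z, hzn, hMz, hadj⟩ := hz
    by_cases hboth : z = x + 1 ∧ y = x + 2
    · obtain ⟨rfl, rfl⟩ := hboth
      rcases hpair (x + 1) hMz (by omega) (by omega) hMx hMy with h | h
      · exact ⟨_, h.2.1, h.2, by omega⟩
      · exact ⟨_, h.1, h, by omega⟩
    · exact ⟨z, hzn, hMz, by omega⟩
  refine exists_efficient_of_landmarks heff (Finset.univ.filter fun v : Fin n => M v) ?_ ?_ ?_
  · refine le_trans ?_ hcard
    refine le_trans ?_ (add_le_add (card_isLandmark_le (fun v : Fin n => (v : ℕ)) Fin.val_injective a)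
      (card_isLandmark_le (fun v : Fin n => n - 1 - (v : ℕ)) (fun u v h => ?_) b))
    · refine le_trans (Finset.card_le_card fun v hv => ?_) (Finset.card_union_le _ _)
      simp only [Finset.mem_union, Finset.mem_filter, Finset.mem_univ, true_and] at hv ⊢
      exact hv.2
    · dsimp only at h
      omega
  · intro x y hxy hx hy
    simp only [Finset.mem_filter, Finset.mem_univ, true_and] at hx hy
    have hne : (x : ℕ) ≠ y := fun h => hxy (Fin.ext h)
    rcases lt_or_gt_of_ne hne with h | h
    · obtain ⟨z, hz, hM, hs⟩ := hsep x y x.2 y.2 h hx hy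
      refine ⟨⟨z, hz⟩, by simpa using hM, ?_⟩
      simpa only [pathGraph_adj] using hs
    · obtain ⟨z, hz, hM, hs⟩ := hsep y x y.2 x.2 h hy hx
      refine ⟨⟨z, hz⟩, by simpa using hM, ?_⟩
      simpa only [pathGraph_adj] using hs.symm
  · intro w hw hwS
    simp only [Finset.mem_filter, Finset.mem_univ, true_and] at hwS
    obtain ⟨z, hz, hM, hadj⟩ := hdom w w.2 (hreach w hw) hwS
    refine ⟨⟨z, hz⟩, by simpa using hM, ?_⟩
    simpa only [pathGraph_adj] using hadj

/-- The case of a cycle, with landmarks placed along the segment of length `a` that starts just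
after the vertex `c`. -/
lemma exists_efficient_cycleGraph {n : ℕ} (hn : 3 ≤ n) {f : Fin n → ℕ}
    (heff : ∑ w, f w = bdim (cycleGraph n)) (c : Fin n)
    {a : ℕ} (ha : (a = n ∧ n ≠ 4) ∨ (a + 1 = n ∧ n ≠ 3))
    (hcard : (2 * a + 4) / 5 ≤ ∑ w, f w)
    (hreach : ∀ w : Fin n, Reaches (cycleGraph n) f w → a = n ∨ n = 4 ∨ w ≠ c) :
    ∃ f' : Fin n → ℕ, IsResolvingBroadcast (cycleGraph n) f' ∧ ∑ w, f' w = bdim (cycleGraph n) ∧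
      (∀ w, Reaches (cycleGraph n) f w → Reaches (cycleGraph n) f' w) ∧ ∀ w, f' w ≤ 1 := by
  classical
  have hc := c.2
  let t : Fin n → ℕ := fun v => if c < v then (v : ℕ) - c - 1 else v + n - c - 1
  have htspec : ∀ v : Fin n, ((c : ℕ) < v ∧ t v = (v : ℕ) - c - 1) ∨
      ((v : ℕ) ≤ c ∧ t v = v + n - c - 1) := by
    intro v
    by_cases h : c < v
    · exact Or.inl ⟨h, if_pos h⟩
    · exact Or.inr ⟨not_lt.1 h, if_neg h⟩
  have htn : ∀ v, t v < n := fun v => by have := htspec v; have := v.2; omega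
  have htinj : Function.Injective t := fun u v h => by
    have := htspec u; have := htspec v; have := u.2; have := v.2; omega
  have htsurj : ∀ p < n, ∃ v : Fin n, t v = p := by
    intro p hp
    by_cases h : p + c + 1 < n
    · have h1 := htspec ⟨p + c + 1, h⟩
      exact ⟨⟨p + c + 1, h⟩, by dsimp only at h1; omega⟩
    · have h1 := htspec ⟨p + c + 1 - n, by omega⟩
      exact ⟨⟨p + c + 1 - n, by omega⟩, by dsimp only at h1; omega⟩
  let C : ℕ → ℕ → Prop := fun x y => x + 1 = y ∨ y + 1 = x ∨ (x = 0 ∧ y + 1 = n) ∨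
    (y = 0 ∧ x + 1 = n)
  have hadj : ∀ u v, (cycleGraph n).Adj u v ↔ C (t u) (t v) := by
    intro u v
    rw [cycleGraph_adj_iff_val (by omega)]
    have := htspec u; have := htspec v; have := u.2; have := v.2
    dsimp only [C]
    omega
  have hdom : ∀ x < n, (x < a ∨ n = 4) → ¬ IsLandmark a x → ∃ z < n, IsLandmark a z ∧ C x z := by
    intro x hx hxa hL
    by_cases hlt : x < a
    · rcases IsLandmark.exists_near hlt with h | h | h
      · exact absurd h hL
      · exact ⟨x - 1, by omega, h.2, by dsimp only [C]; omega⟩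
      · have := h.1
        exact ⟨x + 1, by omega, h, by dsimp only [C]; omega⟩
    · exact ⟨2, by omega, by unfold IsLandmark; omega, by dsimp only [C]; omega⟩
  have hsep : ∀ x y, x < n → y < n → x < y → ¬ IsLandmark a x → ¬ IsLandmark a y →
      ∃ z < n, IsLandmark a z ∧ ((C x z ∧ ¬ C y z) ∨ (C y z ∧ ¬ C x z)) := by
    intro x y hx hy hxy hLx hLy
    obtain ⟨z, hzn, hLz, hxz⟩ := hdom x hx (by omega) hLx
    by_cases hyz : C y z
    · have h0 : 0 < z := by
        unfold IsLandmark at hLz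
        omega
      have hsecond : (2 ≤ z ∧ IsLandmark a (z - 2)) ∨ IsLandmark a (z + 2) := by
        refine hLz.exists_second h0 ?_ ?_
        · have : z - 1 = x ∨ z - 1 = y := by dsimp only [C] at *; omega
          rcases this with h | h <;> rwa [h]
        · have : z + 1 = x ∨ z + 1 = y ∨ a ≤ z + 1 := by dsimp only [C] at *; omega
          rcases this with h | h | h
          · rwa [h]
          · rwa [h]
          · exact fun h' => absurd h'.1 (by omega)
      clear_value t
      rcases hsecond with ⟨h2, h⟩ | h
      · have hx2 : z - 2 ≠ x := fun e => hLx (e ▸ h)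
        have hy2 : z - 2 ≠ y := fun e => hLy (e ▸ h)
        have h4 : n ≠ 4 := by
          unfold IsLandmark at h hLz
          omega
        refine ⟨z - 2, by omega, h, ?_⟩
        dsimp only [C] at *
        omega
      · have hza := h.1
        have h4 : n ≠ 4 := by
          unfold IsLandmark at h
          omega
        refine ⟨z + 2, by omega, h, ?_⟩
        dsimp only [C] at *
        omega
    · exact ⟨z, hzn, hLz, Or.inl ⟨hxz, hyz⟩⟩
  refine exists_efficient_of_landmarks heff (Finset.univ.filter fun v => IsLandmark a (t v)) ?_ ?_ ?_
  · exact (card_isLandmark_le t htinj a).trans hcard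
  · intro x y hxy hx hy
    simp only [Finset.mem_filter, Finset.mem_univ, true_and] at hx hy
    rcases lt_or_gt_of_ne (htinj.ne hxy) with h | h
    · obtain ⟨p, hp, hL, hs⟩ := hsep _ _ (htn x) (htn y) h hx hy
      obtain ⟨z, rfl⟩ := htsurj p hp
      refine ⟨z, by simpa using hL, ?_⟩
      simpa only [hadj] using hs
    · obtain ⟨p, hp, hL, hs⟩ := hsep _ _ (htn y) (htn x) h hy hx
      obtain ⟨z, rfl⟩ := htsurj p hp
      refine ⟨z, by simpa using hL, ?_⟩
      simpa only [hadj] using hs.symm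
  · intro w hw hwS
    simp only [Finset.mem_filter, Finset.mem_univ, true_and] at hwS
    have hwa : t w < a ∨ n = 4 := by
      rcases hreach w hw with h | h | h
      · exact Or.inl (h ▸ htn w)
      · exact Or.inr h
      · have h1 : (w : ℕ) ≠ c := fun h' => h (Fin.ext h')
        have := htspec w
        have := w.2
        omega
    obtain ⟨p, hp, hL, hC⟩ := hdom _ (htn w) hwa hwS
    obtain ⟨z, rfl⟩ := htsurj p hp
    exact ⟨z, by simpa using hL, (hadj _ _).2 hC⟩

/-- For every efficient resolving broadcast `f` of a path `P n` (`n ≥ 1`) or cycle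
`C n` (`n ≥ 3`), there is an efficient resolving broadcast `f'` that reaches every
vertex reached by `f` and satisfies `f' v ≤ 1` for all vertices `v`. -/
theorem exists_efficient_broadcast_le_one (n : ℕ) (hn : 0 < n)
    (G : SimpleGraph (Fin n))
    (hG : G = pathGraph n ∨ (3 ≤ n ∧ G = cycleGraph n))
    (f : Fin n → ℕ) (hf : IsResolvingBroadcast G f)
    (heff : ∑ w, f w = bdim G) :
    ∃ f' : Fin n → ℕ, IsResolvingBroadcast G f' ∧ ∑ w, f' w = bdim G ∧
      (∀ w : Fin n, Reaches G f w → Reaches G f' w) ∧ ∀ w : Fin n, f' w ≤ 1 := by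
  rcases hG with rfl | ⟨h3, rfl⟩
  · have hsph : ∀ z u v w : Fin n, (pathGraph n).edist u z = (pathGraph n).edist v z →
        (pathGraph n).edist v z = (pathGraph n).edist w z →
        (pathGraph n).edist u z ≠ ⊤ → u = v ∨ v = w ∨ u = w := by
      intro z u v w h1 h2 _
      simp only [pathGraph_edist, Nat.cast_inj] at h1 h2
      simp only [Fin.ext_iff]
      omega
    by_cases hall : ∀ w, Reaches (pathGraph n) f w
    · have hlow := hf.two_mul_card_le hsph Finset.univ Finset.univ (fun v _ => hall v)
        (fun _ _ _ _ _ => Finset.mem_univ _)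
      rw [Finset.card_univ, Fintype.card_fin] at hlow
      exact exists_efficient_pathGraph heff (a := n) (b := 0) (Or.inl rfl) (by omega)
        fun _ _ => Or.inl rfl
    · push Not at hall
      obtain ⟨w, hw⟩ := hall
      have hwn := w.2
      have hother : ∀ v, v ≠ w → Reaches (pathGraph n) f v := fun v hv => by
        by_contra h
        exact hv (hf.eq_of_not_reaches h hw)
      have hnot : ∀ z, 0 < f z → f z < (w : ℕ) - z + (z - w) := by
        intro z hz
        by_contra! h
        exact hw ⟨z, hz, by rw [pathGraph_edist]; exact_mod_cast h⟩
      have hleft := hf.two_mul_card_le hsph (Finset.Iio w) (Finset.Iio w)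
        (fun v hv => hother v (Finset.mem_Iio.1 hv).ne) (fun v hv z hz hle => by
          rw [pathGraph_edist, Nat.cast_le] at hle
          have := hnot z hz
          rw [Finset.mem_Iio, Fin.lt_def] at hv ⊢
          omega)
      have hright := hf.two_mul_card_le hsph (Finset.Ioi w) (Finset.Ioi w)
        (fun v hv => hother v (Finset.mem_Ioi.1 hv).ne') (fun v hv z hz hle => by
          rw [pathGraph_edist, Nat.cast_le] at hle
          have := hnot z hz
          rw [Finset.mem_Ioi, Fin.lt_def] at hv ⊢
          omega)
      have hsum : ∑ z ∈ Finset.Iio w, f z + ∑ z ∈ Finset.Ioi w, f z ≤ ∑ z, f z := by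
        rw [← Finset.sum_union (Finset.disjoint_left.2 fun z h1 h2 =>
          lt_asymm (Finset.mem_Iio.1 h1) (Finset.mem_Ioi.1 h2))]
        exact Finset.sum_le_sum_of_subset (Finset.subset_univ _)
      rw [Fin.card_Iio] at hleft
      rw [Fin.card_Ioi] at hright
      refine exists_efficient_pathGraph heff (a := w) (b := n - 1 - w) (Or.inr (by omega))
        (by omega) fun v hv => Or.inr fun h => hw ?_
      rwa [Fin.ext h] at hv
  · have hsph : ∀ z u v w : Fin n, (cycleGraph n).edist u z = (cycleGraph n).edist v z →
        (cycleGraph n).edist v z = (cycleGraph n).edist w z →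
        (cycleGraph n).edist u z ≠ ⊤ → u = v ∨ v = w ∨ u = w := by
      intro z u v w h1 h2 _
      simp only [cycleGraph_edist (by omega : 2 ≤ n), Nat.cast_inj] at h1 h2
      simp only [Fin.ext_iff]
      omega
    by_cases hall : ∀ w, Reaches (cycleGraph n) f w
    · have hlow := hf.two_mul_card_le hsph Finset.univ Finset.univ (fun v _ => hall v)
        (fun _ _ _ _ _ => Finset.mem_univ _)
      rw [Finset.card_univ, Fintype.card_fin] at hlow
      by_cases h4 : n = 4
      · exact exists_efficient_cycleGraph h3 heff ⟨0, hn⟩ (a := 3) (Or.inr (by omega)) (by omega)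
          fun _ _ => Or.inr (Or.inl h4)
      · exact exists_efficient_cycleGraph h3 heff ⟨0, hn⟩ (a := n) (Or.inl ⟨rfl, h4⟩) (by omega)
          fun _ _ => Or.inl rfl
    · push Not at hall
      obtain ⟨w, hw⟩ := hall
      have hother : ∀ v, v ≠ w → Reaches (cycleGraph n) f v := fun v hv => by
        by_contra h
        exact hv (hf.eq_of_not_reaches h hw)
      have hlow := hf.two_mul_card_le hsph (Finset.univ.erase w) Finset.univ
        (fun v hv => hother v (Finset.ne_of_mem_erase hv)) (fun _ _ _ _ _ => Finset.mem_univ _)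
      rw [Finset.card_erase_of_mem (Finset.mem_univ _), Finset.card_univ, Fintype.card_fin] at hlow
      have hn3 : n ≠ 3 := by
        rintro rfl
        obtain ⟨z, hz⟩ : ∃ z, 0 < f z := by
          by_contra! h
          simp [fun z => Nat.le_zero.1 (h z)] at hlow
        refine hw ⟨z, hz, ?_⟩
        rw [cycleGraph_edist (by omega), Nat.cast_le]
        omega
      refine exists_efficient_cycleGraph h3 heff w (a := n - 1) (Or.inr (by omega)) (by omega)
        fun v hv => Or.inr (Or.inr ?_)
      rintro rfl
      exact hw hv
end

section
/- Let T be a tree, let f be a resolving broadcast of T, and let a, b, v, x ∈ V(T) be vertices with f(a) > 0, f(b) > 0, f(v) > 0 satisfying the following inequalities (as integers): f(a) − d_T(a,x) ≥ f(v) − d_T(v,x), f(b) − d_T(b,x) ≥ f(v) − d_T(v,x), and f(a) − d_T(a,v) ≥ f(b) − d_T(b,v). Then every vertex w ∈ V(T) with f(b) ≥ d_T(b,w) and f(v) ≥ d_T(v,w) also satisfies f(a) ≥ d_T(a,w); that is, every vertex of T reached by both b and v is also reached by a. -/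
open SimpleGraph

/-- In a tree, a vertex has at most one neighbor that is closer to a given vertex. -/
lemma SimpleGraph.IsTree.eq_of_adj_of_dist_eq_add_one {V : Type*} {T : SimpleGraph V}
    (hT : T.IsTree) {c u w z : V} (hu : T.Adj u z) (hw : T.Adj w z)
    (hcu : T.dist c z = T.dist c u + 1) (hcw : T.dist c z = T.dist c w + 1) : u = w := by
  obtain ⟨p, hp⟩ := hT.connected.exists_walk_length_eq_dist c u
  obtain ⟨q, hq⟩ := hT.connected.exists_walk_length_eq_dist c w
  have hpp : (p.concat hu).IsPath :=
    (p.concat hu).isPath_of_length_eq_dist (by rw [Walk.length_concat, hp, hcu])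
  have hqp : (q.concat hw).IsPath :=
    (q.concat hw).isPath_of_length_eq_dist (by rw [Walk.length_concat, hq, hcw])
  have h := congrArg Walk.penultimate ((hT.existsUnique_path c z).unique hpp hqp)
  simpa using h

lemma SimpleGraph.Connected.exists_adj_dist_eq_add_one {V : Type*} {G : SimpleGraph V}
    (hG : G.Connected) {a b : V} (hab : a ≠ b) :
    ∃ a', G.Adj a a' ∧ G.dist a b = G.dist a' b + 1 := by
  obtain ⟨p, hp⟩ := hG.exists_walk_length_eq_dist a b
  cases p with
  | nil => exact absurd rfl hab
  | @cons _ a' _ h q =>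
    refine ⟨a', h, ?_⟩
    have h1 := dist_le q
    have h2 := hG.dist_triangle (u := a) (v := a') (w := b)
    have h3 := dist_eq_one_iff_adj.2 h
    rw [Walk.length_cons] at hp
    omega

/-- In a tree, if the edge from `a` to `a'` leads away from `c` and towards `b`, then `a` lies
on the geodesic from `c` to `b`. -/
lemma SimpleGraph.IsTree.dist_eq_add_of_adj {V : Type*} {T : SimpleGraph V} (hT : T.IsTree)
    {a a' b c : V} (h : T.Adj a a') (hc : T.dist c a' = T.dist c a + 1)
    (hb : T.dist a b = T.dist a' b + 1) : T.dist c b = T.dist c a + T.dist a b := by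
  induction hn : T.dist a' b generalizing a a' with
  | zero =>
    obtain rfl := hT.connected.dist_eq_zero_iff.1 hn
    omega
  | succ n ih =>
    have hne : a' ≠ b := by
      rintro rfl
      simp at hn
    obtain ⟨a'', h', hb'⟩ := hT.connected.exists_adj_dist_eq_add_one hne
    have hc' : T.dist c a'' = T.dist c a' + 1 := by
      rcases hT.dist_eq_dist_add_one_of_adj c h' with h1 | h1
      · obtain rfl := hT.eq_of_adj_of_dist_eq_add_one h h'.symm hc h1
        omega
      · exact h1
    have := ih h' hc' hb' (by omega)
    omega

/-- The four-point condition for the distance of a tree. -/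
lemma SimpleGraph.IsTree.four_point {V : Type*} {T : SimpleGraph V} (hT : T.IsTree)
    (a b c d : V) :
    T.dist a b + T.dist c d ≤
      max (T.dist a c + T.dist b d) (T.dist a d + T.dist b c) := by
  induction hn : T.dist a b generalizing a with
  | zero =>
    obtain rfl := hT.connected.dist_eq_zero_iff.1 hn
    have := hT.connected.dist_triangle (u := c) (v := a) (w := d)
    rw [T.dist_comm (u := c) (v := a)] at this
    omega
  | succ n ih =>
    have hne : a ≠ b := by
      rintro rfl
      simp at hn
    obtain ⟨a', h, hb⟩ := hT.connected.exists_adj_dist_eq_add_one hne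
    have key := ih a' (by omega)
    have hcd := hT.connected.dist_triangle (u := c) (v := a) (w := d)
    have hcc := hT.dist_eq_dist_add_one_of_adj c h
    have hdd := hT.dist_eq_dist_add_one_of_adj d h
    have hc := fun hc ↦ hT.dist_eq_add_of_adj (c := c) h hc hb
    have hd := fun hd ↦ hT.dist_eq_add_of_adj (c := d) h hd hb
    have hca := T.dist_comm (u := c) (v := a)
    have hca' := T.dist_comm (u := c) (v := a')
    have hcb := T.dist_comm (u := c) (v := b)
    have hda := T.dist_comm (u := d) (v := a)
    have hda' := T.dist_comm (u := d) (v := a')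
    have hdb := T.dist_comm (u := d) (v := b)
    omega

/-- Let `T` be a tree with resolving broadcast `f` and let `a, b, v, x` be vertices
satisfying `f a - d(a,x) ≥ f v - d(v,x)`, `f b - d(b,x) ≥ f v - d(v,x)` and
`f a - d(a,v) ≥ f b - d(b,v)` (as integers). Then every vertex reached by both `b`
and `v` is also reached by `a`. -/
theorem reached_by_a_of_reached_by_b_and_v {V : Type*} [Fintype V]
    (T : SimpleGraph V) (hT : T.IsTree)
    (f : V → ℕ) (hf : IsResolvingBroadcast T f)
    (a b v x : V) (ha : 0 < f a) (hb : 0 < f b) (hv : 0 < f v)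
    (h1 : (f v : ℤ) - T.dist v x ≤ (f a : ℤ) - T.dist a x)
    (h2 : (f v : ℤ) - T.dist v x ≤ (f b : ℤ) - T.dist b x)
    (h3 : (f b : ℤ) - T.dist b v ≤ (f a : ℤ) - T.dist a v) :
    ∀ w : V, T.dist b w ≤ f b → T.dist v w ≤ f v → T.dist a w ≤ f a := by
  intro w hbw hvw
  have hawvx := hT.four_point a w v x
  have hbvxw := hT.four_point b v x w
  have hwx : T.dist w x = T.dist x w := T.dist_comm
  have hwv : T.dist w v = T.dist v w := T.dist_comm
  omega
end
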